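/- Let γ ∈ (0,1). For every R > 0, I_{∞,γ}(R) = 4π R² ∫_R^∞ K_γ(ρ) sinh²ρ dρ equals (2^γ / (γ |Γ(−γ)|)) · R^{3−γ} · ( I_{1/2}(R) K_{3/2+γ}(R) + I_{3/2}(R) K_{1/2+γ}(R) ). -/

import Mathlib

open MeasureTheory

/-- Modified Bessel function of the second kind:
`K_ν(x) = ∫₀^∞ exp(−x cosh s) cosh(ν s) ds` (so `K_{−ν} = K_ν`). -/
noncomputable def besselK (ν x : ℝ) : ℝ :=
  ∫ s in Set.Ioi (0 : ℝ), Real.exp (-x * Real.cosh s) * Real.cosh (ν * s)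

/-- Modified Bessel function of the first kind:
`I_ν(x) = Σ_{j≥0} (x/2)^{2j+ν}/(j! Γ(ν+j+1))`. -/
noncomputable def besselI (ν x : ℝ) : ℝ :=
  ∑' j : ℕ, (x / 2) ^ (2 * (j : ℝ) + ν) / ((j.factorial : ℝ) * Real.Gamma (ν + j + 1))

/-- Normalizing constant `C(3,γ) = 2^{2γ} Γ(3/2+γ)/(π^{3/2} |Γ(−γ)|)`. -/
noncomputable def C3 (γ : ℝ) : ℝ :=
  2 ^ (2 * γ) * Real.Gamma (3 / 2 + γ) / (Real.pi ^ ((3 : ℝ) / 2) * |Real.Gamma (-γ)|)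

/-- The kernel
`K_γ(ρ) = C(3,γ) (sinh ρ)⁻¹ ρ^{−1/2−γ} · 2 K_{3/2+γ}(ρ) / (Γ(3/2+γ) 2^{3/2+γ})`. -/
noncomputable def Kker (γ ρ : ℝ) : ℝ :=
  C3 γ * (Real.sinh ρ)⁻¹ * ρ ^ (-(1 / 2 : ℝ) - γ) * (2 * besselK (3 / 2 + γ) ρ) /
    (Real.Gamma (3 / 2 + γ) * 2 ^ ((3 : ℝ) / 2 + γ))

/-- Scale function `I_{0,γ}(R) = 4π ∫₀^R ρ² K_γ(ρ) sinh²ρ dρ`. -/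
noncomputable def scaleI0 (γ R : ℝ) : ℝ :=
  4 * Real.pi * ∫ ρ in (0 : ℝ)..R, ρ ^ 2 * Kker γ ρ * (Real.sinh ρ) ^ 2

/-- Scale function `I_{∞,γ}(R) = 4π R² ∫_R^∞ K_γ(ρ) sinh²ρ dρ`. -/
noncomputable def scaleIinf (γ R : ℝ) : ℝ :=
  4 * Real.pi * R ^ 2 * ∫ ρ in Set.Ioi R, Kker γ ρ * (Real.sinh ρ) ^ 2


lemma cosh_lower (s : ℝ) : 1 + s ^ 2 / 2 ≤ Real.cosh s := by
  have h := sum_le_hasSum (Finset.range 2) (fun i _ => by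
    rw [pow_mul]; positivity) (Real.hasSum_cosh s)
  simpa [Finset.sum_range_succ] using h

lemma exp_abs_bound (ν x s : ℝ) (hx : 0 < x) :
    Real.exp (-x * Real.cosh s) * Real.exp (|ν * s|) ≤
      Real.exp (-x) * Real.exp (ν ^ 2 / x) * Real.exp (-(x / 4) * s ^ 2) := by
  rw [← Real.exp_add, ← Real.exp_add, ← Real.exp_add]
  apply Real.exp_le_exp.mpr
  have h1 := cosh_lower s
  have h2 : |ν * s| ≤ ν ^ 2 / x + x * s ^ 2 / 4 := by
    have e : ν ^ 2 / x + x * s ^ 2 / 4 = (ν ^ 2 + (x * s / 2) ^ 2) / x := by field_simp; ring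
    rw [e, le_div_iff₀ hx]
    rcases abs_cases (ν * s) with ⟨h, _⟩ | ⟨h, _⟩ <;> rw [h]
    · nlinarith [sq_nonneg (ν - x * s / 2)]
    · nlinarith [sq_nonneg (ν + x * s / 2)]
  nlinarith [mul_le_mul_of_nonneg_left h1 hx.le]

lemma cosh_le_exp_abs' (t : ℝ) : Real.cosh t ≤ Real.exp |t| := by
  rw [Real.cosh_eq]
  have h1 := Real.exp_le_exp.mpr (le_abs_self t)
  have h2 := Real.exp_le_exp.mpr (neg_le_abs t)
  linarith

lemma abs_sinh_le_exp_abs' (t : ℝ) : |Real.sinh t| ≤ Real.exp |t| := by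
  refine le_trans ?_ (cosh_le_exp_abs' t)
  rw [abs_le]
  rw [Real.cosh_eq, Real.sinh_eq]
  have h1 := Real.exp_pos t
  have h2 := Real.exp_pos (-t)
  constructor <;> linarith

lemma cosh_bound (ν x s : ℝ) (hx : 0 < x) :
    Real.exp (-x * Real.cosh s) * Real.cosh (ν * s) ≤
      Real.exp (-x) * Real.exp (ν ^ 2 / x) * Real.exp (-(x / 4) * s ^ 2) :=
  le_trans (mul_le_mul_of_nonneg_left (cosh_le_exp_abs' _) (Real.exp_pos _).le)
    (exp_abs_bound ν x s hx)

lemma bK_integrable (ν x : ℝ) (hx : 0 < x) :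
    IntegrableOn (fun s => Real.exp (-x * Real.cosh s) * Real.cosh (ν * s)) (Set.Ioi 0) := by
  have hg : IntegrableOn (fun s : ℝ => Real.exp (-x) * Real.exp (ν ^ 2 / x) *
      Real.exp (-(x / 4) * s ^ 2)) (Set.Ioi 0) :=
    ((integrable_exp_neg_mul_sq (b := x / 4) (by positivity)).const_mul _).integrableOn
  refine Integrable.mono' hg (Continuous.aestronglyMeasurable (by fun_prop)) ?_
  refine Filter.Eventually.of_forall fun s => ?_
  rw [Real.norm_of_nonneg (mul_nonneg (Real.exp_pos _).le (Real.cosh_pos _).le)]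
  exact cosh_bound ν x s hx

lemma bK_nonneg (ν x : ℝ) : 0 ≤ besselK ν x :=
  setIntegral_nonneg measurableSet_Ioi fun _ _ =>
    mul_nonneg (Real.exp_pos _).le (Real.cosh_pos _).le

lemma bK_le (ν x : ℝ) (hx : 0 < x) :
    besselK ν x ≤ Real.exp (-x) * Real.exp (ν ^ 2 / x) * (√(Real.pi / (x / 4)) / 2) := by
  rw [← integral_gaussian_Ioi, ← integral_const_mul]
  refine setIntegral_mono (bK_integrable ν x hx) ?_ fun s => cosh_bound ν x s hx
  exact ((integrable_exp_neg_mul_sq (b := x / 4) (by positivity)).const_mul _).integrableOn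

lemma cosh_mul_cosh' (ν s : ℝ) : Real.cosh s * Real.cosh (ν * s) =
    (Real.cosh ((ν + 1) * s) + Real.cosh ((ν - 1) * s)) / 2 := by
  rw [add_mul, sub_mul, one_mul, Real.cosh_add, Real.cosh_sub]; ring

lemma sinh_mul_sinh' (ν s : ℝ) : Real.sinh s * Real.sinh (ν * s) =
    (Real.cosh ((ν + 1) * s) - Real.cosh ((ν - 1) * s)) / 2 := by
  rw [add_mul, sub_mul, one_mul, Real.cosh_add, Real.cosh_sub]; ring

lemma bK_integrable_cosh (ν x : ℝ) (hx : 0 < x) :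
    IntegrableOn (fun s => Real.exp (-x * Real.cosh s) * (Real.cosh s * Real.cosh (ν * s)))
      (Set.Ioi 0) := by
  have := ((bK_integrable (ν + 1) x hx).add (bK_integrable (ν - 1) x hx)).div_const 2
  refine this.congr (Filter.Eventually.of_forall fun s => ?_)
  simp only [cosh_mul_cosh', Pi.add_apply]; ring

lemma bK_hasDerivAt (ν x : ℝ) (hx : 0 < x) :
    HasDerivAt (besselK ν) (-(besselK (ν + 1) x + besselK (ν - 1) x) / 2) x := by
  have key := hasDerivAt_integral_of_dominated_loc_of_deriv_le
    (μ := volume.restrict (Set.Ioi (0 : ℝ))) (x₀ := x) (s := Set.Ioi (x / 2))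
    (F := fun x s => Real.exp (-x * Real.cosh s) * Real.cosh (ν * s))
    (F' := fun x s => -(Real.exp (-x * Real.cosh s) * (Real.cosh s * Real.cosh (ν * s))))
    (bound := fun s => Real.exp (-(x / 2) * Real.cosh s) * (Real.cosh s * Real.cosh (ν * s)))
    (Ioi_mem_nhds (by linarith))
    (Filter.Eventually.of_forall fun y => Continuous.aestronglyMeasurable (by fun_prop))
    (bK_integrable ν x hx)
    (Continuous.aestronglyMeasurable (by fun_prop))
    (Filter.Eventually.of_forall fun s y hy => by
      have h1 := Real.cosh_pos s
      have h2 := Real.cosh_pos (ν * s)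
      have hy' : x / 2 < y := hy
      rw [norm_neg, Real.norm_of_nonneg (by positivity)]
      gcongr)
    (bK_integrable_cosh ν (x / 2) (by positivity))
    (Filter.Eventually.of_forall fun s y hy => by
      have h : HasDerivAt (fun y : ℝ => -y * Real.cosh s) (-1 * Real.cosh s) y :=
        (hasDerivAt_neg y).mul_const _
      refine (h.exp.mul_const (Real.cosh (ν * s))).congr_deriv ?_
      ring)
  refine key.2.congr_deriv ?_
  simp only [besselK]
  rw [← integral_add (bK_integrable (ν + 1) x hx) (bK_integrable (ν - 1) x hx),
    ← integral_neg, ← integral_div]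
  congr 1
  ext s
  rw [cosh_mul_cosh']; ring

lemma bK_rec (ν x : ℝ) (hx : 0 < x) :
    x * (besselK (ν + 1) x - besselK (ν - 1) x) / 2 = ν * besselK ν x := by
  have hi1 := bK_integrable (ν + 1) x hx
  have hi2 := bK_integrable (ν - 1) x hx
  have hi := bK_integrable ν x hx
  have key := integral_Ioi_of_hasDerivAt_of_tendsto' (a := (0 : ℝ)) (m := (0 : ℝ))
    (f := fun s => Real.exp (-x * Real.cosh s) * Real.sinh (ν * s))
    (f' := fun s => ν * (Real.exp (-x * Real.cosh s) * Real.cosh (ν * s)) -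
      x / 2 * (Real.exp (-x * Real.cosh s) * Real.cosh ((ν + 1) * s) -
        Real.exp (-x * Real.cosh s) * Real.cosh ((ν - 1) * s)))
    (fun s _ => by
      have h1 : HasDerivAt (fun s => Real.exp (-x * Real.cosh s))
          (Real.exp (-x * Real.cosh s) * (-x * Real.sinh s)) s :=
        ((Real.hasDerivAt_cosh s).const_mul (-x)).exp
      have h2 : HasDerivAt (fun s => Real.sinh (ν * s)) (Real.cosh (ν * s) * (ν * 1)) s :=
        ((hasDerivAt_id s).const_mul ν).sinh
      refine (h1.mul h2).congr_deriv ?_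
      have := sinh_mul_sinh' ν s
      linear_combination (-x * Real.exp (-x * Real.cosh s)) * this)
    ((hi.const_mul ν).sub ((hi1.sub hi2).const_mul (x / 2)))
    (by
      rw [tendsto_zero_iff_abs_tendsto_zero]
      have hlim : Filter.Tendsto (fun s : ℝ => Real.exp (-x) * Real.exp (ν ^ 2 / x) *
          Real.exp (-(x / 4) * s ^ 2)) Filter.atTop (nhds 0) := by
        have : Filter.Tendsto (fun s : ℝ => -(x / 4) * s ^ 2) Filter.atTop Filter.atBot :=
          (Filter.tendsto_pow_atTop two_ne_zero).const_mul_atTop_of_neg (by linarith)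
        simpa using (Real.tendsto_exp_atBot.comp this).const_mul
          (Real.exp (-x) * Real.exp (ν ^ 2 / x))
      refine squeeze_zero (fun _ => abs_nonneg _) (fun s => ?_) hlim
      simp only [Function.comp_apply]
      rw [abs_mul, abs_of_pos (Real.exp_pos _)]
      exact le_trans (mul_le_mul_of_nonneg_left (abs_sinh_le_exp_abs' _) (Real.exp_pos _).le)
        (exp_abs_bound ν x s hx))
  have hi3 : IntegrableOn (fun s => x / 2 * (Real.exp (-x * Real.cosh s) * Real.cosh ((ν + 1) * s) -
      Real.exp (-x * Real.cosh s) * Real.cosh ((ν - 1) * s))) (Set.Ioi 0) :=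
    (hi1.sub hi2).const_mul (x / 2)
  rw [integral_sub (hi.const_mul ν) hi3, integral_const_mul,
    integral_const_mul, integral_sub hi1 hi2] at key
  simp only [mul_zero, Real.sinh_zero, sub_zero] at key
  simp only [besselK]
  linarith

lemma gamma_fact (j : ℕ) : (j.factorial : ℝ) * Real.Gamma (j + 3 / 2) * 2 ^ (2 * j + 1) =
    ((2 * j + 1).factorial : ℝ) * √Real.pi := by
  induction j with
  | zero =>
    have : Real.Gamma (3 / 2) = 1 / 2 * √Real.pi := by
      rw [← Real.Gamma_one_half_eq, ← Real.Gamma_add_one (by norm_num)]; norm_num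
    simp [this]; ring
  | succ j ih =>
    have h : Real.Gamma (((j + 1 : ℕ) : ℝ) + 3 / 2) = (j + 3 / 2) * Real.Gamma (j + 3 / 2) := by
      rw [← Real.Gamma_add_one (by positivity)]; congr 1; push_cast; ring
    have e : 2 * (j + 1) + 1 = (2 * j + 1) + 1 + 1 := by ring
    rw [h, e, Nat.factorial_succ, Nat.factorial_succ, Nat.factorial_succ (2 * j + 1), pow_succ,
      pow_succ]
    push_cast
    linear_combination ((2 * j + 3) * (2 * j + 2) : ℝ) * ih

lemma rpow_half (x : ℝ) (hx : 0 < x) (n : ℕ) :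
    (x / 2) ^ (2 * (n : ℝ) + 1 / 2) * 2 ^ (2 * n + 1) = √2 * √x * x ^ (2 * n) := by
  rw [Real.rpow_add (by positivity), ← Real.sqrt_eq_rpow, Real.sqrt_div hx.le]
  have : (x / 2) ^ (2 * (n : ℝ)) = (x / 2) ^ (2 * n) := by
    rw [← Real.rpow_natCast]; push_cast; rfl
  rw [this, div_pow, pow_succ]
  have h2 : √2 * √2 = (2 : ℝ) := Real.mul_self_sqrt (by norm_num)
  have h3 : √(2 : ℝ) ≠ 0 := by positivity
  field_simp
  nlinarith [h2]

lemma bI_half (x : ℝ) (hx : 0 < x) :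
    besselI (1 / 2) x = √2 / (√Real.pi * √x) * Real.sinh x := by
  have hxx : √x * √x = x := Real.mul_self_sqrt hx.le
  have hs : √x ≠ 0 := by positivity
  have hp : √Real.pi ≠ 0 := by positivity
  refine (((Real.hasSum_sinh x).mul_left _).congr_fun ?_).tsum_eq
  intro j
  have h1 := gamma_fact j
  have h2 := rpow_half x hx j
  have e : (1 / 2 : ℝ) + j + 1 = j + 3 / 2 := by ring
  have hg : 0 < Real.Gamma ((j : ℝ) + 3 / 2) := Real.Gamma_pos_of_pos (by positivity)
  have hf : ((2 * j + 1).factorial : ℝ) ≠ 0 := by positivity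
  rw [e, ← mul_div_mul_right _ _ (show (2 : ℝ) ^ (2 * j + 1) ≠ 0 by positivity), h1, h2]
  rw [div_mul_div_comm, div_eq_div_iff (by positivity) (by positivity), pow_succ]
  linear_combination √2 * x ^ (2 * j) * √Real.pi * ((2 * j + 1).factorial : ℝ) * hxx

lemma bI_three_half (x : ℝ) (hx : 0 < x) :
    besselI (3 / 2) x = √2 / (√Real.pi * √x) * (Real.cosh x - Real.sinh x / x) := by
  have hxx : √x * √x = x := Real.mul_self_sqrt hx.le
  have hs : √x ≠ 0 := by positivity
  have hp : √Real.pi ≠ 0 := by positivity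
  have hsum := (Real.hasSum_cosh x).sub ((Real.hasSum_sinh x).div_const x)
  rw [← hasSum_nat_add_iff' 1] at hsum
  have hz : Real.cosh x - Real.sinh x / x - ∑ i ∈ Finset.range 1,
      (x ^ (2 * i) / ((2 * i).factorial : ℝ) - x ^ (2 * i + 1) / ((2 * i + 1).factorial : ℝ) / x)
      = Real.cosh x - Real.sinh x / x := by
    simp [hx.ne']
  rw [hz] at hsum
  refine ((hsum.mul_left _).congr_fun ?_).tsum_eq
  intro j
  have h1 := gamma_fact j
  have h2 := rpow_half x hx j
  have e : Real.Gamma ((3 / 2 : ℝ) + j + 1) = (j + 3 / 2) * Real.Gamma (j + 3 / 2) := by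
    rw [← Real.Gamma_add_one (by positivity)]; congr 1; ring
  have e2 : (x / 2) ^ (2 * (j : ℝ) + 3 / 2) = (x / 2) ^ (2 * (j : ℝ) + 1 / 2) * (x / 2) := by
    rw [← Real.rpow_add_one (by positivity)]; congr 1; ring
  have e3 : (j.factorial : ℝ) * ((j + 3 / 2) * Real.Gamma (j + 3 / 2)) * 2 ^ (2 * j + 1) =
      (j + 3 / 2) * (((2 * j + 1).factorial : ℝ) * √Real.pi) := by
    rw [← h1]; ring
  have e4 : (x / 2) ^ (2 * (j : ℝ) + 1 / 2) * (x / 2) * 2 ^ (2 * j + 1) =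
      √2 * √x * x ^ (2 * j) * (x / 2) := by
    rw [← h2]; ring
  have hf : ((2 * j + 1).factorial : ℝ) ≠ 0 := by positivity
  rw [e, e2, ← mul_div_mul_right _ _ (show (2 : ℝ) ^ (2 * j + 1) ≠ 0 by positivity), e3, e4]
  have q1 : 2 * (j + 1) = 2 * j + 1 + 1 := by ring
  rw [q1, Nat.factorial_succ (2 * j + 1 + 1), Nat.factorial_succ (2 * j + 1)]
  push_cast
  have a1 : (2 * (j : ℝ) + 1 + 1) ≠ 0 := by positivity
  have a2 : (2 * (j : ℝ) + 1 + 1 + 1) ≠ 0 := by positivity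
  have a3 : ((j : ℝ) + 3 / 2) ≠ 0 := by positivity
  have hb : √x / 1 = x / √x := by field_simp; linarith
  have hb' : √x = x / √x := by rw [← hb, div_one]
  have hmain : x ^ (2 * j + 1 + 1) / ((2 * (j : ℝ) + 1 + 1) * ((2 * j + 1).factorial : ℝ)) -
      x ^ (2 * j + 1 + 1 + 1) / ((2 * (j : ℝ) + 1 + 1 + 1) *
        ((2 * (j : ℝ) + 1 + 1) * ((2 * j + 1).factorial : ℝ))) / x =
      x ^ (2 * j + 2) / ((2 * j + 3) * ((2 * j + 1).factorial : ℝ)) := by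
    have a4 : (2 * (j : ℝ) + 3) ≠ 0 := by positivity
    field_simp
    ring
  rw [hmain]
  nth_rewrite 1 [hb']
  have a4 : (2 * (j : ℝ) + 3) ≠ 0 := by positivity
  field_simp
  ring

lemma bK_deriv1 (ν x : ℝ) (hx : 0 < x) :
    HasDerivAt (besselK ν) (-besselK (ν - 1) x - ν / x * besselK ν x) x := by
  refine (bK_hasDerivAt ν x hx).congr_deriv ?_
  have := bK_rec ν x hx
  field_simp
  linarith

lemma bK_deriv2 (ν x : ℝ) (hx : 0 < x) :
    HasDerivAt (besselK ν) (-besselK (ν + 1) x + ν / x * besselK ν x) x := by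
  refine (bK_hasDerivAt ν x hx).congr_deriv ?_
  have := bK_rec ν x hx
  field_simp
  linarith

/-- the antiderivative -/
noncomputable def F0 (γ x : ℝ) : ℝ :=
  x ^ (1 / 2 - γ) * (Real.sinh x * besselK (3 / 2 + γ) x +
    (Real.cosh x - Real.sinh x / x) * besselK (1 / 2 + γ) x)

lemma F0_deriv (γ x : ℝ) (hx : 0 < x) :
    HasDerivAt (F0 γ) (-(2 * γ) * (Real.sinh x * x ^ (-(1 / 2 : ℝ) - γ) *
      besselK (3 / 2 + γ) x)) x := by
  have e1 : 3 / 2 + γ - 1 = 1 / 2 + γ := by ring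
  have e2 : 1 / 2 + γ + 1 = 3 / 2 + γ := by ring
  have h1 := bK_deriv1 (3 / 2 + γ) x hx
  have h2 := bK_deriv2 (1 / 2 + γ) x hx
  rw [e1] at h1
  rw [e2] at h2
  have hp : HasDerivAt (fun y : ℝ => y ^ (1 / 2 - γ))
      ((1 / 2 - γ) * x ^ (1 / 2 - γ - 1)) x := Real.hasDerivAt_rpow_const (Or.inl hx.ne')
  have hs := Real.hasDerivAt_sinh x
  have hc := Real.hasDerivAt_cosh x
  refine (hp.mul ((hs.mul h1).add
    ((hc.sub (hs.div (hasDerivAt_id x) hx.ne')).mul h2))).congr_deriv ?_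
  have e3 : x ^ (1 / 2 - γ) = x ^ (-(1 / 2 : ℝ) - γ) * x := by
    rw [← Real.rpow_add_one hx.ne']; congr 1; ring
  have e4 : 1 / 2 - γ - 1 = -(1 / 2 : ℝ) - γ := by ring
  simp only [Pi.add_apply, Pi.mul_apply, Pi.sub_apply, Pi.div_apply, id, e3, e4]
  field_simp
  ring

lemma bK_le' (ν x : ℝ) (hx : 1 ≤ x) :
    Real.exp x * besselK ν x ≤ Real.exp (ν ^ 2) * √Real.pi * x ^ (-(1 / 2) : ℝ) := by
  have hx0 : 0 < x := by linarith
  have h := mul_le_mul_of_nonneg_left (bK_le ν x hx0) (Real.exp_pos x).le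
  refine h.trans ?_
  have e1 : Real.exp x * Real.exp (-x) = 1 := by rw [← Real.exp_add]; simp
  have e2 : √(Real.pi / (x / 4)) / 2 = √Real.pi * x ^ (-(1 / 2) : ℝ) := by
    rw [Real.rpow_neg hx0.le, ← Real.sqrt_eq_rpow, div_div_eq_mul_div, Real.sqrt_div (by positivity),
      Real.sqrt_mul (by positivity)]
    have : √(4 : ℝ) = 2 := by
      rw [show (4 : ℝ) = 2 ^ 2 by norm_num]; exact Real.sqrt_sq (by norm_num)
    rw [this]; field_simp
  rw [e2, ← mul_assoc, ← mul_assoc, ← mul_assoc, e1, one_mul]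
  gcongr
  exact div_le_self (sq_nonneg ν) hx

lemma F0_tendsto (γ : ℝ) (hγ : 0 < γ) :
    Filter.Tendsto (F0 γ) Filter.atTop (nhds 0) := by
  set M := Real.exp ((3 / 2 + γ) ^ 2) * √Real.pi + Real.exp ((1 / 2 + γ) ^ 2) * √Real.pi with hM
  have hlim : Filter.Tendsto (fun x : ℝ => M * x ^ (-γ)) Filter.atTop (nhds 0) := by
    simpa using (tendsto_rpow_neg_atTop hγ).const_mul M
  have hb : ∀ x : ℝ, 1 ≤ x → 0 ≤ Real.cosh x - Real.sinh x / x ∧ 0 ≤ Real.sinh x ∧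
      Real.sinh x ≤ Real.exp x ∧ Real.cosh x - Real.sinh x / x ≤ Real.exp x := by
    intro x hx
    have hx0 : 0 < x := by linarith
    have h1 : 0 ≤ Real.sinh x := Real.sinh_nonneg_iff.mpr hx0.le
    have h2 : Real.sinh x / x ≤ Real.sinh x := div_le_self h1 hx
    have h3 : 0 ≤ Real.sinh x / x := by positivity
    have h4 := Real.sinh_lt_cosh x
    have h5 := Real.cosh_add_sinh x
    have h6 := Real.cosh_pos x
    refine ⟨?_, ?_, ?_, ?_⟩ <;> linarith
  refine squeeze_zero' ?_ ?_ hlim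
  · filter_upwards [Filter.eventually_ge_atTop 1] with x hx
    obtain ⟨h1, h2, -, -⟩ := hb x hx
    have := bK_nonneg (3 / 2 + γ) x
    have := bK_nonneg (1 / 2 + γ) x
    have hx0 : 0 < x := by linarith
    unfold F0
    positivity
  · filter_upwards [Filter.eventually_ge_atTop 1] with x hx
    obtain ⟨-, -, h1, h2⟩ := hb x hx
    have hx0 : 0 < x := by linarith
    have k1 := mul_le_mul_of_nonneg_right h1 (bK_nonneg (3 / 2 + γ) x)
    have k2 := mul_le_mul_of_nonneg_right h2 (bK_nonneg (1 / 2 + γ) x)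
    have k3 := bK_le' (3 / 2 + γ) x hx
    have k4 := bK_le' (1 / 2 + γ) x hx
    have k5 : Real.sinh x * besselK (3 / 2 + γ) x +
        (Real.cosh x - Real.sinh x / x) * besselK (1 / 2 + γ) x ≤ M * x ^ (-(1 / 2) : ℝ) := by
      rw [hM, add_mul]; linarith
    have e : x ^ (-γ) = x ^ (1 / 2 - γ) * x ^ (-(1 / 2) : ℝ) := by
      rw [← Real.rpow_add hx0]; congr 1; ring
    unfold F0
    rw [e]
    calc _ ≤ x ^ (1 / 2 - γ) * (M * x ^ (-(1 / 2) : ℝ)) := by gcongr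
      _ = _ := by ring

lemma F0_integral (γ : ℝ) (hγ : 0 < γ) (R : ℝ) (hR : 0 < R) :
    2 * γ * ∫ x in Set.Ioi R, (Real.sinh x * x ^ (-(1 / 2 : ℝ) - γ) *
      besselK (3 / 2 + γ) x) = F0 γ R := by
  have h := integral_Ioi_of_hasDerivAt_of_nonpos' (a := R) (g := F0 γ)
    (fun x hx => F0_deriv γ x (lt_of_lt_of_le hR hx))
    (fun x hx => by
      have hx0 : 0 < x := lt_trans hR hx
      have h1 : 0 ≤ Real.sinh x := Real.sinh_nonneg_iff.mpr hx0.le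
      have h2 := bK_nonneg (3 / 2 + γ) x
      have : 0 ≤ 2 * γ * (Real.sinh x * x ^ (-(1 / 2 : ℝ) - γ) * besselK (3 / 2 + γ) x) := by
        positivity
      linarith)
    (F0_tendsto γ hγ)
  rw [integral_const_mul] at h
  linarith

/-- part of Lemma 5.1: explicit formula for `I_{∞,γ}(R)` in terms of
modified Bessel functions. -/
theorem scaleIinf_formula (γ : ℝ) (hγ : γ ∈ Set.Ioo (0 : ℝ) 1) (R : ℝ) (hR : 0 < R) :
    scaleIinf γ R =
      (2 : ℝ) ^ γ / (γ * |Real.Gamma (-γ)|) * R ^ ((3 : ℝ) - γ) *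
        (besselI (1 / 2) R * besselK (3 / 2 + γ) R +
          besselI (3 / 2) R * besselK (1 / 2 + γ) R) := by
  obtain ⟨hγ0, -⟩ := hγ
  have hint := F0_integral γ hγ0 R hR
  have hGam : 0 < Real.Gamma (3 / 2 + γ) := Real.Gamma_pos_of_pos (by positivity)
  have hk : ∫ ρ in Set.Ioi R, Kker γ ρ * (Real.sinh ρ) ^ 2 =
      2 * C3 γ / (Real.Gamma (3 / 2 + γ) * 2 ^ ((3 : ℝ) / 2 + γ)) *
      ∫ x in Set.Ioi R, (Real.sinh x * x ^ (-(1 / 2 : ℝ) - γ) * besselK (3 / 2 + γ) x) := by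
    rw [← integral_const_mul]
    refine setIntegral_congr_fun measurableSet_Ioi fun ρ hρ => ?_
    have h1 : Real.sinh ρ ≠ 0 := (Real.sinh_pos_iff.mpr (lt_trans hR hρ)).ne'
    simp only [Kker]
    field_simp
  have hI : ∫ x in Set.Ioi R, (Real.sinh x * x ^ (-(1 / 2 : ℝ) - γ) * besselK (3 / 2 + γ) x) =
      F0 γ R / (2 * γ) := by
    rw [← hint]; field_simp
  rw [scaleIinf, hk, hI, bI_half R hR, bI_three_half R hR, F0, C3]
  have c1 : (2 : ℝ) ^ (2 * γ) = 2 ^ γ * 2 ^ γ := by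
    rw [← Real.rpow_add (by norm_num)]; congr 1; ring
  have c2 : (2 : ℝ) ^ ((3 : ℝ) / 2 + γ) = 2 * √2 * 2 ^ γ := by
    rw [Real.rpow_add (by norm_num), show (3 : ℝ) / 2 = 1 + 1 / 2 by norm_num,
      Real.rpow_add (by norm_num), Real.rpow_one, Real.sqrt_eq_rpow]
  have c3 : Real.pi ^ ((3 : ℝ) / 2) = Real.pi * √Real.pi := by
    rw [show (3 : ℝ) / 2 = 1 + 1 / 2 by norm_num,
      Real.rpow_add Real.pi_pos, Real.rpow_one, Real.sqrt_eq_rpow]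
  have c4 : R ^ ((3 : ℝ) - γ) = R ^ 2 * R ^ (1 / 2 - γ) * √R := by
    rw [Real.sqrt_eq_rpow, ← Real.rpow_natCast, ← Real.rpow_add hR, ← Real.rpow_add hR]
    congr 1; push_cast; ring
  rw [c1, c2, c3, c4]
  have hG : |Real.Gamma (-γ)| ≠ 0 ∨ |Real.Gamma (-γ)| = 0 := (em _).symm
  have hsq : √2 ^ 2 = (2 : ℝ) := Real.sq_sqrt (by norm_num)
  have hp : √Real.pi ≠ 0 := by positivity
  have hr : √R ≠ 0 := by positivity
  have ht : (2 : ℝ) ^ γ ≠ 0 := by positivity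
  rcases hG with hG | hG
  · generalize Real.cosh R - Real.sinh R / R = D
    field_simp
    rw [hsq]
    try ring
  · simp [hG]
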